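/- Let U be a Milliken-Taylor ultrafilter on FIN and let U_{min,max} be the pushforward of U under the map min-max : FIN → ω×ω, x ↦ (min x, max x), i.e., U_{min,max} = {B ⊆ ω×ω : (min-max)⁻¹(B) ∈ U}. Then U_{min,max} ≡_T U_{min,max} · U_{min,max}. -/

import Mathlib

open Set

/-- A subset `S` is bounded with respect to the relation `r`. -/
def RelBounded {α : Type*} (r : α → α → Prop) (S : Set α) : Prop :=
  ∃ b, ∀ a ∈ S, r a b

/-- Tukey reducibility between two ordered sets: there is a map sending every
unbounded set to an unbounded set. -/
def TukeyLE {α β : Type*} (ra : α → α → Prop) (rb : β → β → Prop) : Prop :=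
  ∃ f : α → β, ∀ S : Set α, ¬ RelBounded ra S → ¬ RelBounded rb (f '' S)

/-- Tukey equivalence. -/
def TukeyEquiv {α β : Type*} (ra : α → α → Prop) (rb : β → β → Prop) : Prop :=
  TukeyLE ra rb ∧ TukeyLE rb ra

/-- `S` is cofinal with respect to the relation `r`. -/
def IsCofinalIn {α : Type*} (r : α → α → Prop) (S : Set α) : Prop :=
  ∀ a, ∃ b ∈ S, r a b

/-- The poset `(U, ⊇)` associated to a filter `U`: `A ≤ B` iff `A ⊇ B`. -/
def filtRel {X : Type*} (U : Filter X) :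
    {A : Set X // A ∈ U} → {A : Set X // A ∈ U} → Prop :=
  fun A B => B.1 ⊆ A.1

/-- The poset `(I, ⊆)` associated to a family of sets `I`. -/
def subRel {X : Type*} (I : Set (Set X)) :
    {A : Set X // A ∈ I} → {A : Set X // A ∈ I} → Prop :=
  fun A B => A.1 ⊆ B.1

/-- The Fubini product of filters: `A ∈ U·V` iff `{x | (A)_x ∈ V} ∈ U`,
where `(A)_x = {y | (x, y) ∈ A}`. -/
def fubini {X Y : Type*} (U : Filter X) (V : Filter Y) : Filter (X × Y) :=
  U.bind fun x => V.map (Prod.mk x)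

/-- The ω-fold power of an ordered set, with the everywhere (pointwise)
domination order. -/
def seqRel {α : Type*} (r : α → α → Prop) : (ℕ → α) → (ℕ → α) → Prop :=
  fun f g => ∀ n, r (f n) (g n)

/-- The product order on a Cartesian product of two ordered sets. -/
def prodRel {α β : Type*} (ra : α → α → Prop) (rb : β → β → Prop) :
    α × β → α × β → Prop :=
  fun p q => ra p.1 q.1 ∧ rb p.2 q.2

/-- The everywhere domination order on `ω^ω`. -/
def domRel : (ℕ → ℕ) → (ℕ → ℕ) → Prop := fun f g => ∀ n, f n ≤ g n

/-- An ideal on `X`: a family of subsets containing `∅`, closed under subsets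
and finite unions. -/
def IsIdeal {X : Type*} (I : Set (Set X)) : Prop :=
  ∅ ∈ I ∧ (∀ A ∈ I, ∀ B ⊆ A, B ∈ I) ∧ (∀ A ∈ I, ∀ B ∈ I, A ∪ B ∈ I)

/-- `U` has the `I`-pseudo-intersection property: every ω-sequence of members of `U`
has a pseudo-intersection modulo `I` in `U`. -/
def HasPIP {X : Type*} (U : Filter X) (I : Set (Set X)) : Prop :=
  ∀ A : ℕ → Set X, (∀ n, A n ∈ U) → ∃ B ∈ U, ∀ n, B \ A n ∈ I

/-- A p-point: a nonprincipal ultrafilter on `ω` which has the fin-pseudo-intersection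
property. -/
def IsPPoint (U : Ultrafilter ℕ) : Prop :=
  (∀ a : ℕ, (U : Filter ℕ) ≠ pure a) ∧
  ∀ A : ℕ → Set ℕ, (∀ n, A n ∈ U) → ∃ B ∈ U, ∀ n, (B \ A n).Finite

/-- A rapid ultrafilter: a nonprincipal ultrafilter `U` on `ω` such that for every
increasing `f : ω → ω` there is `X ∈ U` with `|X ∩ f(n)| ≤ n` for all `n`. -/
def IsRapid (U : Ultrafilter ℕ) : Prop :=
  (∀ a : ℕ, (U : Filter ℕ) ≠ pure a) ∧
  ∀ f : ℕ → ℕ, StrictMono f → ∃ X ∈ U, ∀ n, (X ∩ Set.Iio (f n)).ncard ≤ n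

/-- The ideal `fin ⊗ fin` on `ω × ω`: all sets with only finitely many infinite
vertical sections. -/
def finOtimesFin : Set (Set (ℕ × ℕ)) :=
  {A | {n : ℕ | {m : ℕ | (n, m) ∈ A}.Infinite}.Finite}

/-- `FIN`: the nonempty finite subsets of `ω`. -/
abbrev FIN : Type := {s : Finset ℕ // s.Nonempty}

/-- An infinite block sequence: a sequence `⟨x_i : i < ω⟩` in `FIN` with
`max(x_i) < min(x_j)` whenever `i < j`. -/
def IsBlockSeq (X : ℕ → FIN) : Prop :=
  ∀ i j : ℕ, i < j → (X i).1.max' (X i).2 < (X j).1.min' (X j).2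

/-- For an infinite block sequence `X = ⟨x_i : i < ω⟩`,
`[X] = {⋃_{i ∈ s} x_i : s a nonempty finite subset of ω}`. -/
def blockSet (X : ℕ → FIN) : Set FIN :=
  {y | ∃ s : Finset ℕ, s.Nonempty ∧ (y : Finset ℕ) = s.biUnion fun i => (X i).1}

/-- `[X/m]`, where `X/m` is the tail of the block sequence `X` consisting of the
blocks `x_i` with `min(x_i) > m`. -/
def blockSetAbove (X : ℕ → FIN) (m : ℕ) : Set FIN :=
  {y | ∃ s : Finset ℕ, s.Nonempty ∧ (∀ i ∈ s, m < (X i).1.min' (X i).2) ∧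
    (y : Finset ℕ) = s.biUnion fun i => (X i).1}

/-- `Y ≤* X` iff `[Y/m] ⊆ [X]` for some `m`. -/
def leStar (Y X : ℕ → FIN) : Prop := ∃ m : ℕ, blockSetAbove Y m ⊆ blockSet X

/-- A Milliken-Taylor ultrafilter on `FIN`: (1) every member of `U` contains a set
`[X] ∈ U` for some infinite block sequence `X`; (2) every `≤*`-decreasing sequence
of infinite block sequences with `[X_n] ∈ U` has a diagonalization `Y` with
`[Y] ∈ U` and `Y ≤* X_n` for all `n`. -/
def IsMillikenTaylor (U : Ultrafilter FIN) : Prop :=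
  (∀ A ∈ U, ∃ X : ℕ → FIN, IsBlockSeq X ∧ blockSet X ⊆ A ∧ blockSet X ∈ U) ∧
  (∀ Xs : ℕ → ℕ → FIN, (∀ n, IsBlockSeq (Xs n)) → (∀ n, blockSet (Xs n) ∈ U) →
    (∀ n, leStar (Xs (n + 1)) (Xs n)) →
    ∃ Y : ℕ → FIN, IsBlockSeq Y ∧ blockSet Y ∈ U ∧ ∀ n, leStar Y (Xs n))

/-- The map `min-max : FIN → ω × ω`, `x ↦ (min x, max x)`. -/
def minMax (x : FIN) : ℕ × ℕ := ((x : Finset ℕ).min' x.2, (x : Finset ℕ).max' x.2)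

open Filter

/-- The number of elements of `s` that are followed by another element of `s` within the
bound given by `h`. -/
def shortGapCount (h : ℕ → ℕ) (s : Finset ℕ) : ℕ :=
  (s.filter fun a => ∃ b ∈ s, a < b ∧ b ≤ h a).card

theorem shortGapCount_union (h : ℕ → ℕ) {s t : Finset ℕ} (hs : s.Nonempty) (ht : t.Nonempty)
    (hst : s.max' hs < t.min' ht) :
    shortGapCount h (s ∪ t) = shortGapCount h s + shortGapCount h t +
      if t.min' ht ≤ h (s.max' hs) then 1 else 0 := by
  have hM := s.max'_mem hs
  have hm := t.min'_mem ht
  have hM' : ∀ a ∈ s, a ≤ s.max' hs := fun a ha => s.le_max' a ha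
  have hm' : ∀ b ∈ t, t.min' ht ≤ b := fun b hb => t.min'_le b hb
  generalize s.max' hs = M at *
  generalize t.min' ht = m at *
  have hfilter : ((s ∪ t).filter fun a => ∃ b ∈ s ∪ t, a < b ∧ b ≤ h a) =
      ((s.filter fun a => ∃ b ∈ s, a < b ∧ b ≤ h a) ∪
        (t.filter fun a => ∃ b ∈ t, a < b ∧ b ≤ h a)) ∪ (if m ≤ h M then {M} else ∅) := by
    ext a
    have hsplit : a ∈ (if m ≤ h M then {M} else ∅ : Finset ℕ) ↔ m ≤ h M ∧ a = M := by
      split_ifs with hmM <;> simp [hmM]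
    simp only [Finset.mem_union, Finset.mem_filter, hsplit]
    constructor
    · rintro ⟨ha | ha, b, hb | hb, hab, hba⟩
      · exact .inl (.inl ⟨ha, b, hb, hab, hba⟩)
      · rcases (hM' a ha).eq_or_lt with rfl | haM
        · exact .inr ⟨(hm' b hb).trans hba, rfl⟩
        · exact .inl (.inl ⟨ha, M, hM, haM, by have := hm' b hb; omega⟩)
      · have := hM' b hb; have := hm' a ha; omega
      · exact .inl (.inr ⟨ha, b, hb, hab, hba⟩)
    · rintro ((⟨ha, b, hb, hab⟩ | ⟨ha, b, hb, hab⟩) | ⟨hmM, rfl⟩)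
      · exact ⟨.inl ha, b, .inl hb, hab⟩
      · exact ⟨.inr ha, b, .inr hb, hab⟩
      · exact ⟨.inl hM, m, .inr hm, hst, hmM⟩
  rw [shortGapCount, hfilter, Finset.card_union_of_disjoint, Finset.card_union_of_disjoint]
  · unfold shortGapCount
    congr 1
    split_ifs <;> rfl
  · rw [Finset.disjoint_left]
    intro a ha hb
    have := hM' a (Finset.mem_filter.1 ha).1
    have := hm' a (Finset.mem_filter.1 hb).1
    omega
  · rw [Finset.disjoint_left]
    intro a ha hb
    split_ifs at hb
    · rw [Finset.mem_singleton] at hb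
      subst hb
      rcases Finset.mem_union.1 ha with ha | ha
      · obtain ⟨-, b, hb, hab, -⟩ := Finset.mem_filter.1 ha
        have := hM' b hb
        omega
      · have := hm' a (Finset.mem_filter.1 ha).1
        omega
    · simp at hb

theorem mem_blockSet_self (X : ℕ → FIN) (i : ℕ) : X i ∈ blockSet X :=
  ⟨{i}, by simp, by simp⟩

theorem union_mem_blockSet {X : ℕ → FIN} {y z : FIN} (hy : y ∈ blockSet X)
    (hz : z ∈ blockSet X) : (⟨y.1 ∪ z.1, y.2.inl⟩ : FIN) ∈ blockSet X := by
  obtain ⟨s, hs, hys⟩ := hy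
  obtain ⟨t, -, hzt⟩ := hz
  exact ⟨s ∪ t, hs.inl, by rw [Finset.union_biUnion, ← hys, ← hzt]⟩

theorem mem_blockSetAbove {X : ℕ → FIN} {y : FIN} {m : ℕ} (hy : y ∈ blockSet X)
    (hm : m < y.1.min' y.2) : y ∈ blockSetAbove X m := by
  obtain ⟨s, hs, hys⟩ := hy
  refine ⟨s, hs, fun i hi => hm.trans_le (Finset.min'_le _ _ ?_), hys⟩
  rw [hys, Finset.mem_biUnion]
  exact ⟨i, hi, Finset.min'_mem _ _⟩

theorem blockSetAbove_subset (X : ℕ → FIN) (m : ℕ) : blockSetAbove X m ⊆ blockSet X :=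
  fun _ ⟨s, hs, _, hys⟩ => ⟨s, hs, hys⟩

theorem IsBlockSeq.le_min {X : ℕ → FIN} (hX : IsBlockSeq X) (i : ℕ) :
    i ≤ (X i).1.min' (X i).2 := by
  induction i with
  | zero => exact Nat.zero_le _
  | succ i ih =>
    have := hX i (i + 1) (Nat.lt_succ_self i)
    have := (X i).1.min'_le_max' (X i).2
    omega

namespace IsMillikenTaylor

variable {U : Ultrafilter FIN}

theorem lt_min_mem (hU : IsMillikenTaylor U) (k : ℕ) :
    {x : FIN | k < x.1.min' x.2} ∈ U := by
  by_contra hk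
  obtain ⟨X, hX, hXk, -⟩ := hU.1 _ (Ultrafilter.compl_mem_iff_notMem.2 hk)
  exact hXk (mem_blockSet_self X (k + 1)) (hX.le_min (k + 1))

/-- Every member of a Milliken-Taylor ultrafilter contains some `[X]` in the ultrafilter whose
members have gaps between them dominating a prescribed function. -/
theorem exists_long_gaps (hU : IsMillikenTaylor U) (h : ℕ → ℕ) {C : Set FIN} (hC : C ∈ U) :
    ∃ X : ℕ → FIN, blockSet X ⊆ C ∧ blockSet X ∈ U ∧
      ∀ y ∈ blockSet X, ∀ z ∈ blockSet X, y.1.max' y.2 < z.1.min' z.2 →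
        h (y.1.max' y.2) < z.1.min' z.2 := by
  obtain ⟨e, he⟩ : ∃ e, {x : FIN | shortGapCount h x.1 % 2 = e} ∈ U := by
    by_cases h0 : {x : FIN | shortGapCount h x.1 % 2 = 0} ∈ U
    · exact ⟨0, h0⟩
    · refine ⟨1, mem_of_superset (Ultrafilter.compl_mem_iff_notMem.2 h0) fun x hx => ?_⟩
      exact Nat.mod_two_ne_zero.1 hx
  obtain ⟨X, hX, hXC, hXU⟩ := hU.1 _ (inter_mem hC he)
  refine ⟨X, fun x hx => (hXC hx).1, hXU, ?_⟩
  have key : ∀ y ∈ blockSet X, ∀ z ∈ blockSet X, y.1.max' y.2 < z.1.min' z.2 →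
      e = (e + e + if z.1.min' z.2 ≤ h (y.1.max' y.2) then 1 else 0) % 2 := by
    intro y hy z hz hyz
    have hu : shortGapCount h (y.1 ∪ z.1) % 2 = e := (hXC (union_mem_blockSet hy hz)).2
    have hy' : shortGapCount h y.1 % 2 = e := (hXC hy).2
    have hz' : shortGapCount h z.1 % 2 = e := (hXC hz).2
    rw [shortGapCount_union h y.2 z.2 hyz] at hu
    omega
  have he0 : e = 0 := by
    set j := h ((X 0).1.max' (X 0).2) + 1 with hj
    have := key _ (mem_blockSet_self X 0) _ (mem_blockSet_self X j) (hX 0 j (by omega))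
    rw [if_neg (by have := hX.le_min j; omega)] at this
    omega
  intro y hy z hz hyz
  by_contra hle
  have := key y hy z hz hyz
  rw [if_pos (not_lt.1 hle)] at this
  omega

/-- Diagonalization: a sequence of members of a Milliken-Taylor ultrafilter can be diagonalized
along pairs of members of some `[X]` in the ultrafilter. -/
theorem exists_diagonal (hU : IsMillikenTaylor U) {W : ℕ → Set FIN} (hW : ∀ n, W n ∈ U)
    {C : Set FIN} (hC : C ∈ U) :
    ∃ X : ℕ → FIN, blockSet X ⊆ C ∧ blockSet X ∈ U ∧
      ∀ y ∈ blockSet X, ∀ z ∈ blockSet X, y.1.max' y.2 < z.1.min' z.2 →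
        z ∈ W (y.1.max' y.2) := by
  have : Nonempty FIN := ⟨⟨{0}, Finset.singleton_nonempty 0⟩⟩
  choose! F hFblock hFsub hFmem using hU.1
  let Xs : ℕ → ℕ → FIN :=
    fun n => Nat.rec (F (W 0)) (fun n X => F (W (n + 1) ∩ blockSet X)) n
  have hXU : ∀ n, blockSet (Xs n) ∈ U := by
    intro n
    induction n with
    | zero => exact hFmem _ (hW 0)
    | succ n ih => exact hFmem _ (inter_mem (hW _) ih)
  have hXblock : ∀ n, IsBlockSeq (Xs n) := by
    rintro (_ | n)
    · exact hFblock _ (hW 0)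
    · exact hFblock _ (inter_mem (hW _) (hXU n))
  have hXW : ∀ n, blockSet (Xs n) ⊆ W n := by
    rintro (_ | n)
    · exact hFsub _ (hW 0)
    · exact (hFsub _ (inter_mem (hW _) (hXU n))).trans inter_subset_left
  obtain ⟨Z, -, hZU, hZ⟩ := hU.2 Xs hXblock hXU fun n =>
    ⟨0, (blockSetAbove_subset _ _).trans
      ((hFsub _ (inter_mem (hW _) (hXU n))).trans inter_subset_right)⟩
  choose h hh using hZ
  obtain ⟨X, hXC, hXmem, hgap⟩ := hU.exists_long_gaps h (inter_mem hC hZU)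
  refine ⟨X, fun x hx => (hXC hx).1, hXmem, fun y hy z hz hyz => ?_⟩
  exact hXW _ (hh _ (mem_blockSetAbove (hXC hz).2 (hgap y hy z hz hyz)))

end IsMillikenTaylor

theorem mem_fubini {X Y : Type*} {U : Filter X} {V : Filter Y} {A : Set (X × Y)} :
    A ∈ fubini U V ↔ {x | {y | (x, y) ∈ A} ∈ V} ∈ U :=
  Iff.rfl

theorem tukeyLE_of_convergent {α β : Type*} {ra : α → α → Prop} {rb : β → β → Prop}
    (f : α → β) (g : β → α) (hfg : ∀ a b, rb (f a) b → ra a (g b)) : TukeyLE ra rb :=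
  ⟨f, fun _ hS ⟨b, hb⟩ => hS ⟨g b, fun a ha => hfg a b (hb _ (mem_image_of_mem f ha))⟩⟩

theorem tukeyLE_fubini_left {X Y : Type*} (U : Filter X) (V : Filter Y) [V.NeBot] :
    TukeyLE (filtRel U) (filtRel (fubini U V)) := by
  refine tukeyLE_of_convergent
    (fun A => ⟨Prod.fst ⁻¹' A.1, mem_fubini.2 <| mem_of_superset A.2 fun x hx =>
      mem_of_superset univ_mem fun _ _ => hx⟩)
    (fun B => ⟨{x | {y | (x, y) ∈ B.1} ∈ V}, B.2⟩) fun A B hAB x hx => ?_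
  obtain ⟨y, hy⟩ := V.nonempty_of_mem hx
  exact hAB hy

theorem IsMillikenTaylor.exists_minMax_diagonal {U : Ultrafilter FIN} (hU : IsMillikenTaylor U)
    {A : Set ((ℕ × ℕ) × (ℕ × ℕ))}
    (hA : A ∈ fubini (U.map minMax : Filter (ℕ × ℕ)) (U.map minMax : Filter (ℕ × ℕ))) :
    ∃ B ∈ (U.map minMax : Filter (ℕ × ℕ)), ∀ p ∈ B, ∀ q ∈ B, p.2 < q.1 → (p, q) ∈ A := by
  let C : Set (ℕ × ℕ) := {p | {q | (p, q) ∈ A} ∈ (U.map minMax : Filter (ℕ × ℕ))}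
  let W : ℕ → Set FIN := fun n =>
    ⋂ a ∈ Finset.range (n + 1), {x | (a, n) ∈ C → ((a, n), minMax x) ∈ A}
  have hW : ∀ n, W n ∈ U := fun n => by
    refine (biInter_finset_mem _).2 fun a _ => ?_
    by_cases ha : (a, n) ∈ C
    · exact mem_of_superset (show minMax ⁻¹' {q | ((a, n), q) ∈ A} ∈ U from ha) fun x hx _ => hx
    · exact mem_of_superset univ_mem fun x _ h => absurd h ha
  obtain ⟨X, hXC, hXU, hX⟩ :=
    hU.exists_diagonal hW (show minMax ⁻¹' C ∈ U from mem_fubini.1 hA)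
  refine ⟨minMax '' blockSet X, image_mem_map hXU, ?_⟩
  rintro _ ⟨y, hy, rfl⟩ _ ⟨z, hz, rfl⟩ hyz
  exact mem_iInter₂.1 (hX y hy z hz hyz) _
    (Finset.mem_range_succ_iff.2 (y.1.min'_le_max' y.2)) (hXC hy)

/-- If `U` is a Milliken-Taylor ultrafilter on `FIN` and
`U_{min,max}` is the pushforward of `U` under `min-max`, then
`U_{min,max} ≡_T U_{min,max} · U_{min,max}`. -/
theorem stmt19 (U : Ultrafilter FIN) (hU : IsMillikenTaylor U) :
    TukeyEquiv
      (filtRel ((Ultrafilter.map minMax U : Ultrafilter (ℕ × ℕ)) : Filter (ℕ × ℕ)))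
      (filtRel (fubini
        ((Ultrafilter.map minMax U : Ultrafilter (ℕ × ℕ)) : Filter (ℕ × ℕ))
        ((Ultrafilter.map minMax U : Ultrafilter (ℕ × ℕ)) : Filter (ℕ × ℕ)))) := by
  refine ⟨tukeyLE_fubini_left _ _, ?_⟩
  choose f hf hfA using
    fun A : {A // A ∈ fubini (U.map minMax : Filter (ℕ × ℕ)) (U.map minMax : Filter (ℕ × ℕ))} =>
      hU.exists_minMax_diagonal A.2
  refine tukeyLE_of_convergent (fun A => ⟨f A, hf A⟩)
    (fun B => ⟨{r | r.1 ∈ B.1 ∧ r.2 ∈ B.1 ∧ r.1.2 < r.2.1}, mem_fubini.2 ?_⟩) ?_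
  · refine mem_of_superset B.2 fun p hp => ?_
    filter_upwards [B.2, show {q : ℕ × ℕ | p.2 < q.1} ∈ (U.map minMax : Filter (ℕ × ℕ)) from
      hU.lt_min_mem p.2] with q hq hpq
    exact ⟨hp, hq, hpq⟩
  · rintro A B hAB ⟨p, q⟩ ⟨hp, hq, hpq⟩
    exact hfA A p (hAB hp) q (hAB hq) hpq
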